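/- Let C ⊆ F_2^n be the even weight code with n ≥ 5. Then α_{n-3}(C) = 2, i.e., every (n-3)-dimensional subcode of C contains a codeword of Hamming weight 2. -/

import Mathlib

open Module

/-- Hamming weight of a vector. -/
noncomputable def hwt {ι α : Type*} [Zero α] (x : ι → α) : ℕ := {i | x i ≠ 0}.ncard

/-- Minimum distance (minimum weight of a nonzero element) of a code `D`. -/
noncomputable def dminN {𝔽 V : Type*} [Field 𝔽] [AddCommGroup V] [Module 𝔽 V]
    (wt : V → ℕ) (D : Submodule 𝔽 V) : ℕ :=
  sInf (wt '' {v : V | v ∈ D ∧ v ≠ 0})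

/-- The `i`-th code distance of a code `C`: for `i ≤ dim C` the largest minimum distance of
an `i`-dimensional subcode of `C`, and for `i ≥ dim C` the largest minimum distance of an
`i`-dimensional supercode of `C` (both notions agree at `i = dim C`). -/
noncomputable def alphaN {𝔽 V : Type*} [Field 𝔽] [AddCommGroup V] [Module 𝔽 V]
    (wt : V → ℕ) (C : Submodule 𝔽 V) (i : ℕ) : ℕ :=
  if i ≤ finrank 𝔽 C then
    sSup (dminN wt '' {D : Submodule 𝔽 V | D ≤ C ∧ finrank 𝔽 D = i})
  else
    sSup (dminN wt '' {D : Submodule 𝔽 V | C ≤ D ∧ finrank 𝔽 D = i})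

/-- The sum-of-coordinates linear functional on `𝔽_2^n`. -/
def sumMap (n : ℕ) : (Fin n → ZMod 2) →ₗ[ZMod 2] ZMod 2 where
  toFun v := ∑ i, v i
  map_add' := by intro x y; simp [Finset.sum_add_distrib]
  map_smul' := by intro r x; simp [Finset.mul_sum]

/-- The even weight code in `𝔽_2^n`: the code with parity check matrix `(1 ⋯ 1)`,
i.e. all vectors with even Hamming weight. -/
def evenCode (n : ℕ) : Submodule (ZMod 2) (Fin n → ZMod 2) := LinearMap.ker (sumMap n)

theorem finrank_evenCode_aux (n : ℕ) (hn : 5 ≤ n) : finrank (ZMod 2) (evenCode n) = n - 1 := by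
  have hs : LinearMap.range (sumMap n) = ⊤ := by
    rw [LinearMap.range_eq_top]
    intro c
    refine ⟨Pi.single ⟨0, by omega⟩ c, ?_⟩
    change ∑ i, (Pi.single (⟨0, by omega⟩ : Fin n) c : Fin n → ZMod 2) i = c
    simp
  have h := LinearMap.finrank_range_add_finrank_ker (sumMap n)
  rw [hs, finrank_top, finrank_self, finrank_fin_fun] at h
  change finrank (ZMod 2) (LinearMap.ker (sumMap n)) = n - 1
  omega

theorem two_le_hwt_aux (n : ℕ) (v : Fin n → ZMod 2) (hv : v ∈ evenCode n) (h0 : v ≠ 0) :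
    2 ≤ hwt v := by
  have hsum : ∑ i, v i = 0 := hv
  by_contra hlt
  have hc : hwt v = 0 ∨ hwt v = 1 := by omega
  unfold hwt at hc
  rcases hc with hc | hc
  · rw [Set.ncard_eq_zero] at hc
    apply h0
    funext i
    by_contra hi
    have : i ∈ {i | v i ≠ 0} := hi
    rw [hc] at this
    exact this
  · obtain ⟨a, ha⟩ := Set.ncard_eq_one.1 hc
    have hva : v a ≠ 0 := by
      have : a ∈ {i | v i ≠ 0} := by rw [ha]; rfl
      exact this
    apply hva
    rw [← hsum]
    symm
    apply Finset.sum_eq_single a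
    · intro b _ hb
      by_contra hi
      have : b ∈ {i | v i ≠ 0} := hi
      rw [ha] at this
      exact hb this
    · simp

theorem exists_wt_two_aux (n : ℕ) (hn : 5 ≤ n) (D : Submodule (ZMod 2) (Fin n → ZMod 2))
    (hD : D ≤ evenCode n) (hr : finrank (ZMod 2) D = n - 3) : ∃ v ∈ D, hwt v = 2 := by
  let z : Fin n := ⟨0, by omega⟩
  let D' : Submodule (ZMod 2) (evenCode n) := D.comap (evenCode n).subtype
  have hD' : finrank (ZMod 2) D' = n - 3 := by
    rw [← hr]
    exact (Submodule.comapSubtypeEquivOfLe hD).finrank_eq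
  have hq : finrank (ZMod 2) (evenCode n ⧸ D') = 2 := by
    have := D'.finrank_quotient_add_finrank
    rw [hD', finrank_evenCode_aux n hn] at this
    omega
  let e : Fin n → evenCode n := fun i => ⟨Pi.single i 1 - Pi.single z 1, by
    change ∑ j, (Pi.single i 1 - Pi.single z 1 : Fin n → ZMod 2) j = 0
    simp⟩
  classical
  haveI : Finite (evenCode n ⧸ D') := Module.finite_of_finite (ZMod 2)
  haveI := Fintype.ofFinite (evenCode n ⧸ D')
  have hcard : Fintype.card (evenCode n ⧸ D') = 4 := by
    rw [Module.card_eq_pow_finrank (K := ZMod 2), hq, ZMod.card]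
    norm_num
  obtain ⟨i, j, hij, h⟩ := Fintype.exists_ne_map_eq_of_card_lt
    (fun i => D'.mkQ (e i)) (by rw [hcard, Fintype.card_fin]; omega)
  have h2 : e i - e j ∈ D' := (Submodule.Quotient.eq D').1 h
  have h3 : (Pi.single i 1 - Pi.single j 1 : Fin n → ZMod 2) ∈ D := by
    have h4 : ((e i - e j : evenCode n) : Fin n → ZMod 2) ∈ D := h2
    have h5 : ((e i - e j : evenCode n) : Fin n → ZMod 2) = Pi.single i 1 - Pi.single j 1 := by
      simp [e]
    rwa [h5] at h4
  refine ⟨_, h3, ?_⟩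
  unfold hwt
  have : {k | (Pi.single i 1 - Pi.single j 1 : Fin n → ZMod 2) k ≠ 0} = {i, j} := by
    ext k
    simp only [Pi.sub_apply, Pi.single_apply, Set.mem_setOf_eq, Set.mem_insert_iff,
      Set.mem_singleton_iff]
    by_cases h1 : k = i <;> by_cases h2 : k = j <;> simp_all
  rw [this, Set.ncard_pair hij]

theorem dmin_eq_two_aux (n : ℕ) (hn : 5 ≤ n) (D : Submodule (ZMod 2) (Fin n → ZMod 2))
    (hD : D ≤ evenCode n) (hr : finrank (ZMod 2) D = n - 3) : dminN hwt D = 2 := by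
  obtain ⟨v, hv, hw⟩ := exists_wt_two_aux n hn D hD hr
  have h0 : v ≠ 0 := by
    rintro rfl
    simp [hwt] at hw
  apply IsLeast.csInf_eq
  refine ⟨⟨v, ⟨hv, h0⟩, hw⟩, ?_⟩
  rintro _ ⟨u, ⟨hu, hu0⟩, rfl⟩
  exact two_le_hwt_aux n u (hD hu) hu0

/-- For the even weight code `C ⊆ 𝔽_2^n` with `n ≥ 5`, `α_{n-3}(C) = 2`; that is, every
`(n-3)`-dimensional subcode of `C` contains a codeword of Hamming weight `2`. -/
theorem alpha_evenCode_sub_three (n : ℕ) (hn : 5 ≤ n) :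
    alphaN hwt (evenCode n) (n - 3) = 2 ∧
    ∀ D : Submodule (ZMod 2) (Fin n → ZMod 2), D ≤ evenCode n →
      finrank (ZMod 2) D = n - 3 → ∃ v ∈ D, hwt v = 2 := by
  refine ⟨?_, exists_wt_two_aux n hn⟩
  have hle : n - 3 ≤ finrank (ZMod 2) (evenCode n) := by
    rw [finrank_evenCode_aux n hn]; omega
  rw [alphaN, if_pos hle]
  obtain ⟨f, hf⟩ := exists_linearIndependent_of_le_finrank hle
  have hf' : LinearIndependent (ZMod 2) (fun i => (f i : Fin n → ZMod 2)) :=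
    hf.map' (evenCode n).subtype (Submodule.ker_subtype _)
  have hDr := finrank_span_eq_card hf'
  rw [Fintype.card_fin] at hDr
  have hDC : Submodule.span (ZMod 2) (Set.range fun i => (f i : Fin n → ZMod 2)) ≤ evenCode n := by
    rw [Submodule.span_le]
    rintro _ ⟨i, rfl⟩
    exact (f i).2
  apply IsGreatest.csSup_eq
  refine ⟨⟨_, ⟨hDC, hDr⟩, dmin_eq_two_aux n hn _ hDC hDr⟩, ?_⟩
  rintro _ ⟨D, ⟨h1, h2⟩, rfl⟩
  exact (dmin_eq_two_aux n hn D h1 h2).le
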